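/- Let G = (G_1, …, G_m) : ℝⁿ → ℝᵐ have each component G_i convex (hence locally Lipschitz on ℝⁿ). If x̄ ∈ ℝⁿ is a Pareto-Clarke critical point of G, then x̄ is a weak Pareto solution of the problem min{G(x) : x ∈ ℝⁿ}. -/

import Mathlib

open Filter Metric Set
open scoped Topology

/-- The Clarke directional derivative of `f` at `x` in the direction `d`. -/
noncomputable def clarkeDeriv {n : ℕ} (f : EuclideanSpace ℝ (Fin n) → ℝ)
    (x d : EuclideanSpace ℝ (Fin n)) : ℝ :=
  Filter.limsup (fun p : EuclideanSpace ℝ (Fin n) × ℝ => (f (p.1 + p.2 • d) - f p.1) / p.2)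
    ((𝓝 x) ×ˢ (𝓝[>] (0 : ℝ)))

/-- Difference quotients of a convex function are bounded above by the unit-step difference. -/
theorem ConvexOn.diffQuotient_le {E : Type*} [AddCommGroup E] [Module ℝ E] {f : E → ℝ}
    (hf : ConvexOn ℝ univ f) (y d : E) {t : ℝ} (ht₀ : 0 < t) (ht₁ : t ≤ 1) :
    (f (y + t • d) - f y) / t ≤ f (y + d) - f y := by
  have h := hf.2 (mem_univ (y + d)) (mem_univ y) ht₀.le (sub_nonneg.2 ht₁) (by ring)
  have he : t • (y + d) + (1 - t) • y = y + t • d := by module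
  rw [he, smul_eq_mul, smul_eq_mul] at h
  rw [div_le_iff₀ ht₀]
  linarith

/-- Difference quotients of a convex function are bounded below by the backward unit-step
difference. -/
theorem ConvexOn.le_diffQuotient {E : Type*} [AddCommGroup E] [Module ℝ E] {f : E → ℝ}
    (hf : ConvexOn ℝ univ f) (y d : E) {t : ℝ} (ht₀ : 0 < t) :
    f y - f (y - d) ≤ (f (y + t • d) - f y) / t := by
  have hs : 0 < 1 + t := by linarith
  have h := hf.2 (mem_univ (y + t • d)) (mem_univ (y - d)) (inv_pos.2 hs).le
    (div_pos ht₀ hs).le (by field_simp)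
  have he : (1 + t)⁻¹ • (y + t • d) + (t / (1 + t)) • (y - d) = y := by
    match_scalars <;> field_simp
    ring
  rw [he, smul_eq_mul, smul_eq_mul, inv_mul_eq_div, div_mul_eq_mul_div, ← add_div,
    le_div_iff₀ hs] at h
  rw [le_div_iff₀ ht₀]
  linarith

/-- The Clarke directional derivative of a convex function satisfies the subgradient-type
inequality `f°(x, d) ≤ f (x + d) - f x`. -/
theorem ConvexOn.clarkeDeriv_le {n : ℕ} {f : EuclideanSpace ℝ (Fin n) → ℝ}
    (hf : ConvexOn ℝ univ f) (x d : EuclideanSpace ℝ (Fin n)) :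
    clarkeDeriv f x d ≤ f (x + d) - f x := by
  have hc : Continuous f := continuousOn_univ.1 (hf.continuousOn isOpen_univ)
  have hfst : Tendsto Prod.fst ((𝓝 x) ×ˢ (𝓝[>] (0 : ℝ))) (𝓝 x) := tendsto_fst
  have hupper : Tendsto (fun p : EuclideanSpace ℝ (Fin n) × ℝ => f (p.1 + d) - f p.1)
      ((𝓝 x) ×ˢ (𝓝[>] (0 : ℝ))) (𝓝 (f (x + d) - f x)) :=
    ((by fun_prop : Continuous fun y => f (y + d) - f y).tendsto x).comp hfst
  have hlower : Tendsto (fun p : EuclideanSpace ℝ (Fin n) × ℝ => f p.1 - f (p.1 - d))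
      ((𝓝 x) ×ˢ (𝓝[>] (0 : ℝ))) (𝓝 (f x - f (x - d))) :=
    ((by fun_prop : Continuous fun y => f y - f (y - d)).tendsto x).comp hfst
  have ht : ∀ᶠ p : EuclideanSpace ℝ (Fin n) × ℝ in (𝓝 x) ×ˢ (𝓝[>] (0 : ℝ)),
      p.2 ∈ Ioc (0 : ℝ) 1 :=
    tendsto_snd.eventually (Ioc_mem_nhdsGT zero_lt_one)
  rw [← hupper.limsup_eq]
  refine limsup_le_limsup ?_ ?_ hupper.isBoundedUnder_le
  · filter_upwards [ht] with p hp using hf.diffQuotient_le p.1 d hp.1 hp.2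
  · refine IsBoundedUnder.isCoboundedUnder_le (hlower.isBoundedUnder_ge.mono_ge ?_)
    filter_upwards [ht] with p hp using hf.le_diffQuotient p.1 d hp.1

/-- If each component of `G` is convex and `x̄` is a Pareto-Clarke critical point of `G`,
then `x̄` is a weak Pareto solution of `min {G(x) : x ∈ ℝⁿ}`. -/
theorem paretoClarke_critical_implies_weak_pareto {n m : ℕ}
    (G : Fin m → EuclideanSpace ℝ (Fin n) → ℝ)
    (hconv : ∀ i, ∀ x y : EuclideanSpace ℝ (Fin n), ∀ t ∈ Set.Icc (0 : ℝ) 1,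
      G i (t • x + (1 - t) • y) ≤ t * G i x + (1 - t) * G i y)
    (xbar : EuclideanSpace ℝ (Fin n))
    (hcrit : ∀ d : EuclideanSpace ℝ (Fin n), ∃ i, 0 ≤ clarkeDeriv (G i) xbar d) :
    ¬ ∃ x : EuclideanSpace ℝ (Fin n), ∀ i, G i x < G i xbar := by
  rintro ⟨x, hx⟩
  obtain ⟨i, hi⟩ := hcrit (x - xbar)
  have hf : ConvexOn ℝ univ (G i) := by
    refine ⟨convex_univ, fun y _ z _ a b ha hb hab => ?_⟩
    obtain rfl : b = 1 - a := by linarith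
    exact hconv i y z a ⟨ha, by linarith⟩
  have h := hf.clarkeDeriv_le xbar (x - xbar)
  rw [add_sub_cancel] at h
  linarith [hx i]
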